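/- Assume the main configuration. Let U ≠ Y be the second intersection of line PY with Ω, and assume no three of A, B, C, P, U are collinear. Then line PP′ is tangent to the conic (ABCPU) at P. -/

import Mathlib

noncomputable section

/-- The line through the points `u` and `v`. -/
def lineThrough (u v : ℂ) : Set ℂ := {z : ℂ | ∃ t : ℝ, z = u + t • (v - u)}

/-- A subset of `ℂ` is a line if it is the line through two distinct points. -/
def IsLine (L : Set ℂ) : Prop := ∃ u v : ℂ, u ≠ v ∧ L = lineThrough u v

/-- The circle with center `O` and radius `r`. -/
def circleSet (O : ℂ) (r : ℝ) : Set ℂ := {z : ℂ | ‖z - O‖ = r}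

/-- The value at `z` of the real quadratic polynomial with coefficients `a, b, c, d, e, f`
in the coordinates `x = Re z`, `y = Im z`. -/
def conicEval (a b c d e f : ℝ) (z : ℂ) : ℝ :=
  a * z.re ^ 2 + b * z.re * z.im + c * z.im ^ 2 + d * z.re + e * z.im + f

/-- The gradient at `z` of the real quadratic polynomial with coefficients
`a, b, c, d, e, f`, regarded as a complex number. -/
def conicGrad (a b c d e f : ℝ) (z : ℂ) : ℂ :=
  ((2 * a * z.re + b * z.im + d : ℝ) : ℂ) + ((b * z.re + 2 * c * z.im + e : ℝ) : ℂ) * Complex.I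

/-- A conic: the zero set of a nonzero real polynomial of total degree at most 2 in the
coordinates `x = Re z`, `y = Im z`. -/
def IsConic (S : Set ℂ) : Prop :=
  ∃ a b c d e f : ℝ, ¬(a = 0 ∧ b = 0 ∧ c = 0 ∧ d = 0 ∧ e = 0 ∧ f = 0) ∧
    S = {z : ℂ | conicEval a b c d e f z = 0}

/-- The line through `Z` perpendicular to the (nonzero) vector `g`. -/
def perpLineAt (Z g : ℂ) : Set ℂ :=
  {w : ℂ | (w - Z).re * g.re + (w - Z).im * g.im = 0}

/-- `L` is the tangent line of the conic `S` at the point `Z`: for some defining polynomial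
`f` of `S` vanishing at `Z` with `∇f(Z) ≠ 0`, `L` is the line through `Z` perpendicular
to `∇f(Z)`. -/
def IsConicTangentLineAt (S : Set ℂ) (Z : ℂ) (L : Set ℂ) : Prop :=
  ∃ a b c d e f : ℝ, ¬(a = 0 ∧ b = 0 ∧ c = 0 ∧ d = 0 ∧ e = 0 ∧ f = 0) ∧
    S = {z : ℂ | conicEval a b c d e f z = 0} ∧
    conicEval a b c d e f Z = 0 ∧ conicGrad a b c d e f Z ≠ 0 ∧
    L = perpLineAt Z (conicGrad a b c d e f Z)

/-- The circle with center `O` and radius `r` and the conic `S` are tangent at `Z`: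
both pass through `Z` and the tangent line of the circle at `Z` (the line through `Z`
perpendicular to the radius) is the tangent line of the conic at `Z`. -/
def CircleConicTangentAt (O : ℂ) (r : ℝ) (S : Set ℂ) (Z : ℂ) : Prop :=
  Z ∈ circleSet O r ∧ Z ∈ S ∧ IsConicTangentLineAt S Z (perpLineAt Z (Z - O))

/-- `P` and `P'` are isogonal conjugates with respect to the triangle `ABC`. -/
def IsogConj (A B C P P' : ℂ) : Prop :=
  ((P - A) * (P' - A) / ((B - A) * (C - A))).im = 0 ∧
  ((P - B) * (P' - B) / ((C - B) * (A - B))).im = 0 ∧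
  ((P - C) * (P' - C) / ((A - C) * (B - C))).im = 0

/-- No three of the points in the list `l` are collinear. -/
def NoThreeCollinear (l : List ℂ) : Prop :=
  ∀ i j k : Fin l.length, i ≠ j → i ≠ k → j ≠ k →
    ¬ Collinear ℝ ({l.get i, l.get j, l.get k} : Set ℂ)

/-- Four points lie on a common circle. -/
def Concyclic4 (A B C D : ℂ) : Prop :=
  ∃ O : ℂ, ∃ r : ℝ, 0 < r ∧ A ∈ circleSet O r ∧ B ∈ circleSet O r ∧
    C ∈ circleSet O r ∧ D ∈ circleSet O r

/-- Orthogonal reflection of `z` across the line through `u` with direction `v`. -/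
def reflAcross (u v z : ℂ) : ℂ :=
  u + v / (starRingEnd ℂ) v * (starRingEnd ℂ) (z - u)

/-- `O'` is a center of `S`: the point reflection about `O'` maps `S` onto itself. -/
def IsCenter (S : Set ℂ) (O' : ℂ) : Prop :=
  (fun z => 2 * O' - z) '' S = S


open ComplexConjugate

/-- A quartic with four distinct roots has its coefficients given by Vieta's formulas. -/
lemma quartic_coeffs_of_roots {K : Type*} [Field K] {k₄ k₃ k₂ k₁ k₀ a b c d : K}
    (hab : a ≠ b) (hac : a ≠ c) (hbc : b ≠ c) (hda : d ≠ a) (hdb : d ≠ b) (hdc : d ≠ c)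
    (ha : k₄ * a ^ 4 + k₃ * a ^ 3 + k₂ * a ^ 2 + k₁ * a + k₀ = 0)
    (hb : k₄ * b ^ 4 + k₃ * b ^ 3 + k₂ * b ^ 2 + k₁ * b + k₀ = 0)
    (hc : k₄ * c ^ 4 + k₃ * c ^ 3 + k₂ * c ^ 2 + k₁ * c + k₀ = 0)
    (hd : k₄ * d ^ 4 + k₃ * d ^ 3 + k₂ * d ^ 2 + k₁ * d + k₀ = 0) :
    k₃ = -k₄ * (a + b + c + d) ∧
    k₂ = k₄ * (a * b + a * c + b * c + d * (a + b + c)) ∧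
    k₁ = -k₄ * (a * b * c + d * (a * b + a * c + b * c)) ∧
    k₀ = k₄ * (a * b * c * d) := by
  have first (x : K) (hx : x ≠ a)
      (h : k₄ * x ^ 4 + k₃ * x ^ 3 + k₂ * x ^ 2 + k₁ * x + k₀ = 0) :
      k₄ * (x ^ 3 + x ^ 2 * a + x * a ^ 2 + a ^ 3) + k₃ * (x ^ 2 + x * a + a ^ 2)
        + k₂ * (x + a) + k₁ = 0 := by
    refine mul_left_cancel₀ (sub_ne_zero.2 hx) ?_
    linear_combination h - ha
  have hb' := first b hab.symm hb
  have second (x : K) (hxa : x ≠ a) (hxb : x ≠ b)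
      (h : k₄ * x ^ 4 + k₃ * x ^ 3 + k₂ * x ^ 2 + k₁ * x + k₀ = 0) :
      k₄ * (x ^ 2 + x * b + b ^ 2 + a * (x + b) + a ^ 2) + k₃ * (x + b + a) + k₂ = 0 := by
    refine mul_left_cancel₀ (sub_ne_zero.2 hxb) ?_
    linear_combination first x hxa h - hb'
  have hc' := second c hac.symm hbc.symm hc
  have hd' := second d hda hdb hd
  have h₃ : k₃ = -k₄ * (a + b + c + d) := by
    refine mul_left_cancel₀ (sub_ne_zero.2 hdc) ?_
    linear_combination hd' - hc'
  have h₂ : k₂ = k₄ * (a * b + a * c + b * c + d * (a + b + c)) := by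
    linear_combination hc' - (c + b + a) * h₃
  have h₁ : k₁ = -k₄ * (a * b * c + d * (a * b + a * c + b * c)) := by
    linear_combination hb' - (b ^ 2 + b * a + a ^ 2) * h₃ - (b + a) * h₂
  refine ⟨h₃, h₂, h₁, ?_⟩
  linear_combination ha - a ^ 3 * h₃ - a ^ 2 * h₂ - a * h₁

/-- A real quadratic polynomial written in the coordinate `w` with `z = O + r w`. -/
lemma conicEval_eq_complex (a b c d e f : ℝ) (O : ℂ) (r : ℝ) :
    ∃ α γ β δ : ℂ, ∀ w : ℂ, (conicEval a b c d e f (O + r * w) : ℂ) =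
      α * w ^ 2 + β * w * conj w + conj α * conj w ^ 2 + γ * w + conj γ * conj w + δ := by
  refine ⟨r ^ 2 * ((a - c) - b * Complex.I) / 4,
    r * ((2 * a * O.re + b * O.im + d) - (b * O.re + 2 * c * O.im + e) * Complex.I) / 2,
    r ^ 2 * (a + c) / 2, conicEval a b c d e f O, fun w => ?_⟩
  apply Complex.ext <;> simp [conicEval, pow_two, Complex.conj_ofNat] <;> ring

lemma mul_conj_eq_one_of_norm_eq_one {z : ℂ} (hz : ‖z‖ = 1) : z * conj z = 1 := by
  rw [Complex.mul_conj, Complex.normSq_eq_norm_sq, hz]; simp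

/-- A conic through four distinct points `a, b, c, u` of the unit circle belongs to the pencil
spanned by the unit circle and a conic determined by the elementary symmetric functions. -/
lemma pencil_coeffs {α γ β δ a b c u : ℂ}
    (ha : a * conj a = 1) (hb : b * conj b = 1) (hc : c * conj c = 1) (hu : u * conj u = 1)
    (hab : a ≠ b) (hac : a ≠ c) (hbc : b ≠ c) (hua : u ≠ a) (hub : u ≠ b) (huc : u ≠ c)
    (h : ∀ w ∈ ({a, b, c, u} : Set ℂ), α * w ^ 2 + β * w * conj w + conj α * conj w ^ 2
      + γ * w + conj γ * conj w + δ = 0) :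
    γ = -α * (a + b + c + u) ∧
    δ = α * (a * b + a * c + b * c + u * (a + b + c)) - β ∧
    conj γ = -α * (a * b * c + u * (a * b + a * c + b * c)) ∧
    conj α = α * (a * b * c * u) := by
  have quartic (w : ℂ) (hw : w * conj w = 1) (h : α * w ^ 2 + β * w * conj w
      + conj α * conj w ^ 2 + γ * w + conj γ * conj w + δ = 0) :
      α * w ^ 4 + γ * w ^ 3 + (β + δ) * w ^ 2 + conj γ * w + conj α = 0 := by
    linear_combination w ^ 2 * h - (β * w ^ 2 + conj α * (w * conj w + 1) + conj γ * w) * hw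
  obtain ⟨h₃, h₂, h₁, h₀⟩ := quartic_coeffs_of_roots hab hac hbc hua hub huc
    (quartic a ha (h a (by simp))) (quartic b hb (h b (by simp)))
    (quartic c hc (h c (by simp))) (quartic u hu (h u (by simp)))
  exact ⟨h₃, by linear_combination h₂, h₁, h₀⟩

/-- The isogonality condition at the vertex `a`, for a triangle inscribed in the unit circle. -/
lemma isogonal_at_vertex {a b c p q : ℂ}
    (ha : a * conj a = 1) (hb : b * conj b = 1) (hc : c * conj c = 1)
    (hab : a ≠ b) (hac : a ≠ c)
    (h : ((p - a) * (q - a) / ((b - a) * (c - a))).im = 0) :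
    p * q + a * b * c * (conj p + conj q) - (a * b + a * c + b * c) =
      a * (p + q + a * b * c * conj p * conj q - (a + b + c)) := by
  have hab' : b - a ≠ 0 := sub_ne_zero.2 hab.symm
  have hac' : c - a ≠ 0 := sub_ne_zero.2 hac.symm
  have hreal := Complex.conj_eq_iff_im.2 h
  simp only [map_div₀, map_mul, map_sub] at hreal
  have hab'' : conj b - conj a ≠ 0 := by simpa [← map_sub] using hab'
  have hac'' : conj c - conj a ≠ 0 := by simpa [← map_sub] using hac'
  rw [div_eq_div_iff (mul_ne_zero hab'' hac'') (mul_ne_zero hab' hac')] at hreal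
  have e₁ : a * b * (conj b - conj a) = a - b := by linear_combination a * hb - b * ha
  have e₂ : a * c * (conj c - conj a) = a - c := by linear_combination a * hc - c * ha
  refine mul_left_cancel₀ (mul_ne_zero hab' hac') ?_
  have e₃ : a * (conj p - conj a) = a * conj p - 1 := by linear_combination -ha
  have e₄ : a * (conj q - conj a) = a * conj q - 1 := by linear_combination -ha
  have key : (a * conj p - 1) * (a * conj q - 1) * ((b - a) * (c - a)) * (b * c) =
      (p - a) * (q - a) * ((a - b) * (a - c)) := by
    rw [← e₁, ← e₂, ← e₃, ← e₄]
    linear_combination a ^ 2 * b * c * hreal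
  linear_combination -key

/-- Isogonal conjugates with respect to a triangle inscribed in the unit circle. -/
lemma isogonal_relations {a b c p q : ℂ}
    (ha : a * conj a = 1) (hb : b * conj b = 1) (hc : c * conj c = 1)
    (hab : a ≠ b) (hac : a ≠ c) (hbc : b ≠ c) (h : IsogConj a b c p q) :
    a + b + c = p + q + a * b * c * conj p * conj q ∧
    a * b + a * c + b * c = p * q + a * b * c * (conj p + conj q) := by
  have h₁ := isogonal_at_vertex ha hb hc hab hac h.1
  have h₂ := isogonal_at_vertex hb hc ha hbc hab.symm h.2.1
  have h₃ : p + q + a * b * c * conj p * conj q - (a + b + c) = 0 := by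
    refine mul_left_cancel₀ (sub_ne_zero.2 hab) ?_
    linear_combination h₂ - h₁
  exact ⟨by linear_combination -h₃, by linear_combination -h₁ - a * h₃⟩

/-- A point with an isogonal conjugate and distinct from the vertices is off the circumcircle. -/
lemma mul_conj_ne_one_of_isogonal {a b c p q : ℂ}
    (h₁ : a + b + c = p + q + a * b * c * conj p * conj q)
    (h₂ : a * b + a * c + b * c = p * q + a * b * c * (conj p + conj q))
    (hpa : p ≠ a) (hpb : p ≠ b) (hpc : p ≠ c) : p * conj p - 1 ≠ 0 := by
  intro hp
  have : (p - a) * (p - b) * (p - c) = 0 := by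
    linear_combination (-p ^ 2) * h₁ + p * h₂ + (a * b * c) * hp - p * a * b * c * conj q * hp
  simp [sub_eq_zero, hpa, hpb, hpc] at this

/-- The chord equation of the unit circle. -/
lemma chord_eq {y d q : ℂ} {t : ℝ} (hy : y * conj y = 1) (hd : d * conj d = 1) (hyd : y ≠ d)
    (h : y - d = t * (q - d)) : y + d = q + y * d * conj q := by
  have h' : conj y - conj d = t * (conj q - conj d) := by simpa using congrArg conj h
  have ht : (t : ℂ) ≠ 0 := by
    rintro h0
    rw [h0, zero_mul, sub_eq_zero] at h
    exact hyd h
  refine mul_left_cancel₀ (mul_ne_zero ht (sub_ne_zero.2 hyd)) ?_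
  linear_combination (y - d) * y * d * h' - (d - y) * h - (y - d) * (d * hy - y * hd)
    - t * (y - d) * y * hd

/-- On a conic of the pencil through `a, b, c, u` passing through `p`, the coefficient of the
unit circle is determined by the isogonal conjugate `q` of `p`. -/
lemma pencil_through_isogonal {α β γ δ γ' α' a b c u p q p' q' : ℂ}
    (hγ : γ = -α * (a + b + c + u))
    (hδ : δ = α * (a * b + a * c + b * c + u * (a + b + c)) - β)
    (hγ' : γ' = -α * (a * b * c + u * (a * b + a * c + b * c)))
    (hα' : α' = α * (a * b * c * u))
    (h₁ : a + b + c = p + q + a * b * c * p' * q')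
    (h₂ : a * b + a * c + b * c = p * q + a * b * c * (p' + q'))
    (hp : p * p' - 1 ≠ 0)
    (h : α * p ^ 2 + β * p * p' + α' * p' ^ 2 + γ * p + γ' * p' + δ = 0) :
    β = α * (a * b * c * q' + u * q) := by
  refine mul_left_cancel₀ hp ?_
  subst hγ hδ hγ' hα'
  linear_combination h - α * (1 - u * p') * h₂ + α * (p - u) * h₁

/-- The conic of the pencil through `p` takes equal values at `q` and at its reflection in `p`. -/
lemma tangency_identity {α β γ δ γ' α' a b c d u y p q p' q' : ℂ}
    (hγ : γ = -α * (a + b + c + u))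
    (hγ' : γ' = -α * (a * b * c + u * (a * b + a * c + b * c)))
    (hα' : α' = α * (a * b * c * u))
    (h₁ : a + b + c = p + q + a * b * c * p' * q')
    (h₂ : a * b + a * c + b * c = p * q + a * b * c * (p' + q'))
    (hβ : β = α * (a * b * c * q' + u * q))
    (hd : d * (q - p) = -(a * b * c) * (q' - p'))
    (hy : y + d = q + y * d * q') (hu : u + y = p + u * y * p') :
    α * q ^ 2 + β * q * q' + α' * q' ^ 2 + γ * q + γ' * q' + δ =
    α * (2 * p - q) ^ 2 + β * (2 * p - q) * (2 * p' - q') + α' * (2 * p' - q') ^ 2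
      + γ * (2 * p - q) + γ' * (2 * p' - q') + δ := by
  have key : (2 * p - (a + b + c + u)) * (q - p)
      - (a * b * c + u * (a * b + a * c + b * c)) * (q' - p')
      + 2 * (a * b * c * u) * p' * (q' - p')
      + (a * b * c * q' + u * q) * ((q - p) * p' + p * (q' - p')) = 0 := by
    linear_combination (-(q - p)) * h₁ - u * (q' - p') * h₂
      - (1 - q' * p + u * (q' - p')) * hd
      + (q - p) * (1 - u * p') * hy - (q - p) * (1 - d * q') * hu
  subst hγ hγ' hα' hβ
  linear_combination 2 * α * key

/-- The central difference of a quadratic polynomial is its directional derivative. -/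
lemma conicEval_sub_reflection (a b c d e f : ℝ) (z w : ℂ) :
    conicEval a b c d e f w - conicEval a b c d e f (2 * z - w) =
      2 * ((w - z).re * (conicGrad a b c d e f z).re
        + (w - z).im * (conicGrad a b c d e f z).im) := by
  simp [conicEval, conicGrad]; ring

lemma conicEval_coeffs_eq_zero {a b c d e f : ℝ} (h : ∀ z, conicEval a b c d e f z = 0) :
    a = 0 ∧ b = 0 ∧ c = 0 ∧ d = 0 ∧ e = 0 ∧ f = 0 := by
  have h₀ := h 0
  have h₁ := h 1
  have h₂ := h (-1)
  have h₃ := h Complex.I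
  have h₄ := h (-Complex.I)
  have h₅ := h (1 + Complex.I)
  simp [conicEval] at h₀ h₁ h₂ h₃ h₄ h₅
  refine ⟨?_, ?_, ?_, ?_, ?_, ?_⟩ <;> linarith

lemma cross_ne_zero_of_not_collinear {A B P : ℂ} (h : ¬ Collinear ℝ ({A, B, P} : Set ℂ)) :
    (A - P).re * (B - P).im - (A - P).im * (B - P).re ≠ 0 := by
  intro h0
  apply h
  by_cases hAP : A = P
  · subst hAP
    rw [Set.pair_comm, Set.insert_eq_of_mem (by simp)]
    exact collinear_pair ℝ _ _
  have hAP' : A - P ≠ 0 := sub_ne_zero.2 hAP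
  have him : ((B - P) / (A - P)).im = 0 := by
    rw [Complex.div_im, ← sub_div]
    simp only [div_eq_zero_iff]
    left; linear_combination h0
  refine (collinear_iff_of_mem (p₀ := P) (by simp)).2 ⟨A - P, ?_⟩
  rintro x (rfl | rfl | rfl)
  · exact ⟨1, by simp⟩
  · refine ⟨((x - P) / (A - P)).re, ?_⟩
    have : ((((x - P) / (A - P)).re : ℝ) : ℂ) = (x - P) / (A - P) :=
      Complex.ext (by simp) (by simp [him])
    rw [Complex.real_smul, this, div_mul_cancel₀ _ hAP']
    simp
  · exact ⟨0, by simp⟩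

lemma binary_quadratic_form_eq_zero {a b c x₁ y₁ x₂ y₂ x₃ y₃ : ℝ}
    (h₁₂ : x₁ * y₂ - y₁ * x₂ ≠ 0) (h₁₃ : x₁ * y₃ - y₁ * x₃ ≠ 0) (h₂₃ : x₂ * y₃ - y₂ * x₃ ≠ 0)
    (h₁ : a * x₁ ^ 2 + b * x₁ * y₁ + c * y₁ ^ 2 = 0)
    (h₂ : a * x₂ ^ 2 + b * x₂ * y₂ + c * y₂ ^ 2 = 0)
    (h₃ : a * x₃ ^ 2 + b * x₃ * y₃ + c * y₃ ^ 2 = 0) : a = 0 ∧ b = 0 ∧ c = 0 := by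
  have hne := mul_ne_zero (mul_ne_zero h₁₂ h₁₃) h₂₃
  refine ⟨?_, ?_, ?_⟩ <;> refine (mul_eq_zero.1 ?_).resolve_left hne
  · linear_combination y₂ * y₃ * (x₂ * y₃ - y₂ * x₃) * h₁
      - y₁ * y₃ * (x₁ * y₃ - y₁ * x₃) * h₂ + y₁ * y₂ * (x₁ * y₂ - y₁ * x₂) * h₃
  · linear_combination -(x₂ * y₃ + y₂ * x₃) * (x₂ * y₃ - y₂ * x₃) * h₁
      + (x₁ * y₃ + y₁ * x₃) * (x₁ * y₃ - y₁ * x₃) * h₂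
      - (x₁ * y₂ + y₁ * x₂) * (x₁ * y₂ - y₁ * x₂) * h₃
  · linear_combination x₂ * x₃ * (x₂ * y₃ - y₂ * x₃) * h₁
      - x₁ * x₃ * (x₁ * y₃ - y₁ * x₃) * h₂ + x₁ * x₂ * (x₁ * y₂ - y₁ * x₂) * h₃

/-- A conic through `A, B, C, P` is smooth at `P` if no line through `P` contains two of
`A, B, C`. -/
lemma conicGrad_ne_zero {a b c d e f : ℝ} {A B C P : ℂ}
    (hne : ¬(a = 0 ∧ b = 0 ∧ c = 0 ∧ d = 0 ∧ e = 0 ∧ f = 0))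
    (hA : conicEval a b c d e f A = 0) (hB : conicEval a b c d e f B = 0)
    (hC : conicEval a b c d e f C = 0) (hP : conicEval a b c d e f P = 0)
    (hAB : ¬ Collinear ℝ ({A, B, P} : Set ℂ)) (hAC : ¬ Collinear ℝ ({A, C, P} : Set ℂ))
    (hBC : ¬ Collinear ℝ ({B, C, P} : Set ℂ)) : conicGrad a b c d e f P ≠ 0 := by
  intro hg
  have hre : 2 * a * P.re + b * P.im + d = 0 := by
    simpa [conicGrad] using congrArg Complex.re hg
  have him : b * P.re + 2 * c * P.im + e = 0 := by
    simpa [conicGrad] using congrArg Complex.im hg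
  have form (z : ℂ) (hz : conicEval a b c d e f z = 0) :
      a * (z - P).re ^ 2 + b * (z - P).re * (z - P).im + c * (z - P).im ^ 2 = 0 := by
    simp only [conicEval, Complex.sub_re, Complex.sub_im] at *
    linear_combination hz - hP - (z.re - P.re) * hre - (z.im - P.im) * him
  obtain ⟨rfl, rfl, rfl⟩ := binary_quadratic_form_eq_zero (cross_ne_zero_of_not_collinear hAB)
    (cross_ne_zero_of_not_collinear hAC) (cross_ne_zero_of_not_collinear hBC)
    (form A hA) (form B hB) (form C hC)
  obtain rfl : d = 0 := by linarith
  obtain rfl : e = 0 := by linarith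
  exact hne ⟨rfl, rfl, rfl, rfl, rfl, by simpa [conicEval] using hP⟩

lemma lineThrough_eq_perpLineAt {P Q g : ℂ} (hPQ : P ≠ Q) (hg : g ≠ 0)
    (h : (Q - P).re * g.re + (Q - P).im * g.im = 0) : lineThrough P Q = perpLineAt P g := by
  ext z
  simp only [lineThrough, perpLineAt, Set.mem_ofPred_eq]
  constructor
  · rintro ⟨t, rfl⟩
    simp at h ⊢
    linear_combination t * h
  · intro hz
    have hcross : (Q - P).re * (z - P).im - (Q - P).im * (z - P).re = 0 := by
      by_contra hne
      apply hg
      apply Complex.ext <;> refine (mul_eq_zero.1 ?_).resolve_left hne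
      · linear_combination (z - P).im * h - (Q - P).im * hz
      · linear_combination (Q - P).re * hz - (z - P).re * h
    have hcol : Collinear ℝ ({Q, z, P} : Set ℂ) := by
      by_contra hn
      exact cross_ne_zero_of_not_collinear hn hcross
    have hmem := hcol.mem_affineSpan_of_mem_of_ne (p₁ := P) (p₂ := Q) (p₃ := z)
      (by simp) (by simp) (by simp) hPQ
    obtain ⟨t, rfl⟩ := mem_affineSpan_pair_iff_exists_lineMap_eq.1 hmem
    exact ⟨t, by simp [AffineMap.lineMap_apply, add_comm]⟩

lemma ne_of_not_collinear {A B C : ℂ} (h : ¬ Collinear ℝ ({A, B, C} : Set ℂ)) :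
    A ≠ B ∧ A ≠ C ∧ B ≠ C := by
  refine ⟨?_, ?_, ?_⟩ <;> rintro rfl <;> apply h <;> simp [collinear_pair]

lemma NoThreeCollinear.not_collinear_get {A B C P Q : ℂ} (h : NoThreeCollinear [A, B, C, P, Q])
    (i j k : Fin 5) (hijk : i ≠ j ∧ i ≠ k ∧ j ≠ k) :
    ¬ Collinear ℝ ({[A, B, C, P, Q].get i, [A, B, C, P, Q].get j,
      [A, B, C, P, Q].get k} : Set ℂ) :=
  h i j k hijk.1 hijk.2.1 hijk.2.2

/-- The unit-circle coordinate of a point of the circle with center `O` and radius `r`. -/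
lemma exists_unit_coordinate {O : ℂ} {r : ℝ} (hr : 0 < r) {z : ℂ} (hz : z ∈ circleSet O r) :
    ∃ w : ℂ, z = O + r * w ∧ w * conj w = 1 := by
  have hr' : (r : ℂ) ≠ 0 := by exact_mod_cast hr.ne'
  refine ⟨(z - O) / r, by field_simp; ring, mul_conj_eq_one_of_norm_eq_one ?_⟩
  have hz' : ‖z - O‖ = r := hz
  rw [norm_div, hz', Complex.norm_real, Real.norm_of_nonneg hr.le]
  exact div_self (ne_of_gt hr)

/-- Isogonal conjugacy is invariant under homotheties and translations. -/
lemma isogConj_of_affine {O : ℂ} {r : ℝ} (hr : (r : ℂ) ≠ 0) {a b c p q : ℂ}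
    (h : IsogConj (O + r * a) (O + r * b) (O + r * c) (O + r * p) (O + r * q)) :
    IsogConj a b c p q := by
  have ratio (x y z w v : ℂ) : (O + r * x - (O + r * v)) * (O + r * y - (O + r * v)) /
      ((O + r * z - (O + r * v)) * (O + r * w - (O + r * v))) =
      (x - v) * (y - v) / ((z - v) * (w - v)) := by
    rw [show (O + r * x - (O + r * v)) * (O + r * y - (O + r * v)) =
        r ^ 2 * ((x - v) * (y - v)) by ring,
      show (O + r * z - (O + r * v)) * (O + r * w - (O + r * v)) =
        r ^ 2 * ((z - v) * (w - v)) by ring, mul_div_mul_left _ _ (pow_ne_zero 2 hr)]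
  simpa only [IsogConj, ratio] using h

theorem statement18
    (A B C O : ℂ) (r : ℝ) (Ω : Set ℂ)
    (hr : 0 < r) (hΩ : Ω = circleSet O r)
    (hAΩ : A ∈ Ω) (hBΩ : B ∈ Ω) (hCΩ : C ∈ Ω)
    (hABC : ¬ Collinear ℝ ({A, B, C} : Set ℂ))
    (P P' : ℂ) (hPP' : P ≠ P') (hconj : IsogConj A B C P P')
    (h5 : NoThreeCollinear [A, B, C, P, P'])
    (H : Set ℂ) (hH : IsConic H)
    (hAH : A ∈ H) (hBH : B ∈ H) (hCH : C ∈ H) (hPH : P ∈ H) (hP'H : P' ∈ H)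
    (D : ℂ) (hDΩ : D ∈ Ω) (hDH : D ∈ H) (hDA : D ≠ A) (hDB : D ≠ B) (hDC : D ≠ C)
    (hDP : D ≠ P) (hDP' : D ≠ P')
    (X : ℂ) (hXD : X ≠ D) (hXΩ : X ∈ Ω) (hXline : X ∈ lineThrough D P)
    (Y : ℂ) (hYD : Y ≠ D) (hYΩ : Y ∈ Ω) (hYline : Y ∈ lineThrough D P')
    (hPXY : ¬ Collinear ℝ ({P, X, Y} : Set ℂ))
    (O₁ : ℂ) (r₁ : ℝ) (hr₁ : 0 < r₁)
    (hPγ : P ∈ circleSet O₁ r₁) (hXγ : X ∈ circleSet O₁ r₁) (hYγ : Y ∈ circleSet O₁ r₁)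
    (Z : ℂ) (hZP : Z ≠ P) (hZγ : Z ∈ circleSet O₁ r₁) (hZline : Z ∈ lineThrough P P')
    (U : ℂ) (hUY : U ≠ Y) (hUΩ : U ∈ Ω) (hUl : U ∈ lineThrough P Y)
    (h5U : NoThreeCollinear [A, B, C, P, U])
    (C₂ : Set ℂ) (hC₂ : IsConic C₂)
    (hAC₂ : A ∈ C₂) (hBC₂ : B ∈ C₂) (hCC₂ : C ∈ C₂) (hPC₂ : P ∈ C₂) (hUC₂ : U ∈ C₂) :
    IsConicTangentLineAt C₂ P (lineThrough P P') := by
  subst hΩ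
  have hr' : (r : ℂ) ≠ 0 := by exact_mod_cast hr.ne'
  obtain ⟨a, rfl, ha⟩ := exists_unit_coordinate hr hAΩ
  obtain ⟨b, rfl, hb⟩ := exists_unit_coordinate hr hBΩ
  obtain ⟨c, rfl, hc⟩ := exists_unit_coordinate hr hCΩ
  obtain ⟨d, rfl, hd⟩ := exists_unit_coordinate hr hDΩ
  obtain ⟨y, rfl, hy⟩ := exists_unit_coordinate hr hYΩ
  obtain ⟨u, rfl, hu⟩ := exists_unit_coordinate hr hUΩ
  obtain ⟨p, rfl⟩ : ∃ p : ℂ, P = O + r * p := ⟨(P - O) / r, by field_simp; ring⟩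
  obtain ⟨q, rfl⟩ : ∃ q : ℂ, P' = O + r * q := ⟨(P' - O) / r, by field_simp; ring⟩
  have hABP := h5.not_collinear_get 0 1 3 (by decide)
  have hACP := h5.not_collinear_get 0 2 3 (by decide)
  have hBCP := h5.not_collinear_get 1 2 3 (by decide)
  obtain ⟨hab, hap, hbp⟩ := ne_of_not_collinear hABP
  obtain ⟨hac, -, hcp⟩ := ne_of_not_collinear hACP
  obtain ⟨hbc, -, -⟩ := ne_of_not_collinear hBCP
  obtain ⟨-, haq, hbq⟩ := ne_of_not_collinear (h5.not_collinear_get 0 1 4 (by decide))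
  obtain ⟨-, -, hcq⟩ := ne_of_not_collinear (h5.not_collinear_get 0 2 4 (by decide))
  obtain ⟨-, hau, hbu⟩ := ne_of_not_collinear (h5U.not_collinear_get 0 1 4 (by decide))
  obtain ⟨-, -, hcu⟩ := ne_of_not_collinear (h5U.not_collinear_get 0 2 4 (by decide))
  simp [hr'] at hab hap hbp hac hcp hbc haq hbq hcq hau hbu hcu hDA hDB hDC hYD hUY
  obtain ⟨h₁, h₂⟩ := isogonal_relations ha hb hc hab hac hbc (isogConj_of_affine hr' hconj)
  have hp := mul_conj_ne_one_of_isogonal h₁ h₂ (Ne.symm hap) (Ne.symm hbp) (Ne.symm hcp)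
  have h₁' : a + b + c = q + p + a * b * c * conj q * conj p := by linear_combination h₁
  have h₂' : a * b + a * c + b * c = q * p + a * b * c * (conj q + conj p) := by
    linear_combination h₂
  have hq := mul_conj_ne_one_of_isogonal h₁' h₂' (Ne.symm haq) (Ne.symm hbq) (Ne.symm hcq)
  have hdw : d * (q - p) = -(a * b * c) * (conj q - conj p) := by
    obtain ⟨k₁, k₂, k₃, k₄, k₅, k₆, hne, rfl⟩ := hH
    obtain ⟨α, γ, β, δ, hk⟩ := conicEval_eq_complex k₁ k₂ k₃ k₄ k₅ k₆ O r
    have hval {w : ℂ} (hw : conicEval k₁ k₂ k₃ k₄ k₅ k₆ (O + r * w) = 0) :=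
      (hk w).symm.trans (by rw [hw, Complex.ofReal_zero])
    obtain ⟨hγ, hδ, hγ', hα'⟩ := pencil_coeffs ha hb hc hd hab hac hbc hDA hDB hDC
      (α := α) (γ := γ) (β := β) (δ := δ) (by
        rintro w (rfl | rfl | rfl | rfl)
        exacts [hval hAH, hval hBH, hval hCH, hval hDH])
    have hβ := pencil_through_isogonal hγ hδ hγ' hα' h₁ h₂ hp (hval hPH)
    have hβ' := pencil_through_isogonal hγ hδ hγ' hα' h₁' h₂' hq (hval hP'H)
    have hα : α ≠ 0 := by
      rintro rfl
      refine hne (conicEval_coeffs_eq_zero fun z => ?_)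
      have hz := hk ((z - O) / r)
      rw [mul_div_cancel₀ _ hr', add_sub_cancel] at hz
      rw [zero_mul] at hβ
      subst hβ
      simp at hγ hδ
      simpa [hγ, hδ] using hz
    refine mul_left_cancel₀ hα ?_
    linear_combination hβ' - hβ
  have hy' : y + d = q + y * d * conj q := by
    obtain ⟨t, ht⟩ := hYline
    refine chord_eq hy hd hYD (t := t) (mul_left_cancel₀ hr' ?_)
    rw [Complex.real_smul] at ht
    linear_combination ht
  have hu' : u + y = p + u * y * conj p := by
    obtain ⟨t, ht⟩ := hUl
    refine chord_eq hu hy hUY (t := 1 - t) (mul_left_cancel₀ hr' ?_)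
    rw [Complex.real_smul] at ht
    push_cast
    linear_combination ht
  obtain ⟨k₁, k₂, k₃, k₄, k₅, k₆, hne, rfl⟩ := hC₂
  have hgrad := conicGrad_ne_zero hne hAC₂ hBC₂ hCC₂ hPC₂ hABP hACP hBCP
  refine ⟨k₁, k₂, k₃, k₄, k₅, k₆, hne, rfl, hPC₂, hgrad,
    lineThrough_eq_perpLineAt hPP' hgrad ?_⟩
  obtain ⟨α, γ, β, δ, hk⟩ := conicEval_eq_complex k₁ k₂ k₃ k₄ k₅ k₆ O r
  have hval {w : ℂ} (hw : conicEval k₁ k₂ k₃ k₄ k₅ k₆ (O + r * w) = 0) :=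
    (hk w).symm.trans (by rw [hw, Complex.ofReal_zero])
  obtain ⟨hγ, hδ, hγ', hα'⟩ := pencil_coeffs ha hb hc hu hab hac hbc
    (Ne.symm hau) (Ne.symm hbu) (Ne.symm hcu) (α := α) (γ := γ) (β := β) (δ := δ) (by
      rintro w (rfl | rfl | rfl | rfl)
      exacts [hval hAC₂, hval hBC₂, hval hCC₂, hval hUC₂])
  have hβ := pencil_through_isogonal hγ hδ hγ' hα' h₁ h₂ hp (hval hPC₂)
  have hsym : conicEval k₁ k₂ k₃ k₄ k₅ k₆ (O + r * q) =
      conicEval k₁ k₂ k₃ k₄ k₅ k₆ (2 * (O + r * p) - (O + r * q)) := by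
    rw [show 2 * (O + r * p) - (O + r * q) = O + r * (2 * p - q) by ring,
      ← Complex.ofReal_inj, hk, hk]
    simpa [Complex.conj_ofNat] using tangency_identity (δ := δ) hγ hγ' hα' h₁ h₂ hβ hdw hy' hu'
  linarith [conicEval_sub_reflection k₁ k₂ k₃ k₄ k₅ k₆ (O + r * p) (O + r * q)]

end
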